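/- Let X be a complex Banach space, α ∈ (0, π/2], M > 0, and let A ⊆ X × X be a closed relation such that the open sector Σ_{α+π/2} = {r e^{iθ} : r > 0, |θ| < α + π/2} is contained in ρ(A) and ‖λ R(λ,A)‖ ≤ M for all λ ∈ Σ_{α+π/2}. Then there exists a holomorphic map T : Σ_α → ℒ(X) such that T(z₁ + z₂) = T(z₁)T(z₂) for all z₁, z₂ ∈ Σ_α, ‖T(z)‖ ≤ M(1 + 2eπ/sin ε) for all z ∈ Σ_{α−ε} and all 0 < ε < α, and R(λ,A)x = ∫₀^∞ e^{-λt} T(t)x dt for all real λ > 0 and all x ∈ X (i.e. A generates the bounded holomorphic semigroup T). -/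

import Mathlib

open Filter Topology MeasureTheory

/-- `Q ∈ ℒ(X)` is the resolvent of the relation `A ⊆ X × X` at `l`, i.e. the relation
`l - A = {(x, l•x - y) : (x,y) ∈ A}` is invertible and `(l - A)⁻¹` is the graph of `Q`.
(In particular `l` belongs to the resolvent set `ρ(A)`.) -/
def IsResolventOf {X : Type*} [NormedAddCommGroup X] [NormedSpace ℂ X]
    (A : Submodule ℂ (X × X)) (l : ℂ) (Q : X →L[ℂ] X) : Prop :=
  ∀ u x : X, (∃ y, (x, y) ∈ A ∧ u = l • x - y) ↔ x = Q u

/-- The open sector `Σ_β = {r e^{iθ} : r > 0, |θ| < β}` in `ℂ`. -/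
def sector (β : ℝ) : Set ℂ :=
  {z : ℂ | z ≠ 0 ∧ |Complex.arg z| < β}

namespace Sectorial

set_option linter.unusedSectionVars false

variable {E : Type*} [NormedAddCommGroup E] [NormedSpace ℂ E]

/-- The part over a horizontal half-line of the inverse Laplace integral of `F`, in the
logarithmic variable. -/
noncomputable def rayIntegral (z : ℂ) (F : ℂ → E) (c y : ℝ) : E :=
  ∫ s in Set.Ioi c, Complex.exp (z * Complex.exp (s + y * Complex.I)) • F (s + y * Complex.I)

/-- The part over a vertical segment of the inverse Laplace integral of `F`, in the
logarithmic variable. -/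
noncomputable def segIntegral (z : ℂ) (F : ℂ → E) (c a b : ℝ) : E :=
  ∫ y in a..b, Complex.exp (z * Complex.exp (c + y * Complex.I)) • F (c + y * Complex.I)

/-- The inverse Laplace integral `(2πi)⁻¹ ∫ exp (z exp ζ) F(ζ) dζ` over the U-shaped contour
consisting of the half-lines `[c, ∞) ± iθ` and the segment between `c - iθ` and `c + iθ`.
In the variable `λ = exp ζ` this is a keyhole contour around the negative half-line. -/
noncomputable def hankel (z : ℂ) (F : ℂ → E) (c θ : ℝ) : E :=
  (2 * Real.pi * Complex.I : ℂ)⁻¹ •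
    (rayIntegral z F c θ - rayIntegral z F c (-θ) + Complex.I • segIntegral z F c (-θ) θ)

/-- Continuity on a closed strip and growth at most like `exp ζ`. -/
structure Admissible (F : ℂ → E) (c θ : ℝ) : Prop where
  cont : ContinuousOn F {ζ | |ζ.im| ≤ θ}
  bound : ∃ C, ∀ ζ : ℂ, c ≤ ζ.re → |ζ.im| ≤ θ → ‖F ζ‖ ≤ C * Real.exp ζ.re

theorem norm_kernel (z : ℂ) (s y : ℝ) :
    ‖Complex.exp (z * Complex.exp (s + y * Complex.I))‖ =
      Real.exp (Real.exp s * (z * Complex.exp (y * Complex.I)).re) := by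
  rw [Complex.norm_exp, Complex.exp_add, ← Complex.ofReal_exp,
    show z * ((Real.exp s : ℂ) * Complex.exp (y * Complex.I)) =
      (Real.exp s : ℂ) * (z * Complex.exp (y * Complex.I)) by ring, Complex.re_ofReal_mul]

theorem norm_kernel_le {z : ℂ} {y κ : ℝ} (hκ : 0 < κ)
    (h : (z * Complex.exp (y * Complex.I)).re ≤ -κ) (s : ℝ) :
    ‖Complex.exp (z * Complex.exp (s + y * Complex.I))‖ ≤ 2 / κ ^ 2 * Real.exp (-2 * s) := by
  rw [norm_kernel]
  have hs := Real.exp_pos s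
  have h1 : Real.exp s * (z * Complex.exp (y * Complex.I)).re ≤ -(κ * Real.exp s) := by nlinarith
  refine (Real.exp_le_exp.2 h1).trans ?_
  have h2 : (κ * Real.exp s) ^ 2 / 2 ≤ Real.exp (κ * Real.exp s) := by
    have := Real.quadratic_le_exp_of_nonneg (x := κ * Real.exp s) (by positivity)
    have : 0 < κ * Real.exp s := by positivity
    linarith
  rw [Real.exp_neg, show (-2 * s) = -(s + s) by ring, Real.exp_neg, Real.exp_add]
  calc (Real.exp (κ * Real.exp s))⁻¹ ≤ ((κ * Real.exp s) ^ 2 / 2)⁻¹ := by gcongr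
    _ = _ := by field_simp

theorem Admissible.sub {F G : ℂ → E} {c θ : ℝ} (hF : Admissible F c θ) (hG : Admissible G c θ) :
    Admissible (fun ζ => F ζ - G ζ) c θ := by
  obtain ⟨C, hC⟩ := hF.bound
  obtain ⟨D, hD⟩ := hG.bound
  refine ⟨hF.cont.sub hG.cont, C + D, fun ζ h1 h2 => ?_⟩
  rw [add_mul]
  exact (norm_sub_le _ _).trans (add_le_add (hC ζ h1 h2) (hD ζ h1 h2))

theorem Admissible.clm {E' : Type*} [NormedAddCommGroup E'] [NormedSpace ℂ E'] (L : E →L[ℂ] E')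
    {F : ℂ → E} {c θ : ℝ} (hF : Admissible F c θ) : Admissible (fun ζ => L (F ζ)) c θ := by
  obtain ⟨C, hC⟩ := hF.bound
  refine ⟨L.continuous.comp_continuousOn hF.cont, ‖L‖ * C, fun ζ h1 h2 => ?_⟩
  rw [mul_assoc]
  exact (L.le_opNorm _).trans (by gcongr; exact hC ζ h1 h2)

theorem Admissible.of_bounded {F : ℂ → E} {θ : ℝ} (hF : ContinuousOn F {ζ | |ζ.im| ≤ θ})
    {C : ℝ} (hC : ∀ ζ : ℂ, |ζ.im| ≤ θ → ‖F ζ‖ ≤ C) (c : ℝ) : Admissible F c θ := by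
  refine ⟨hF, max C 0 * Real.exp (-c), fun ζ h1 h2 => (hC ζ h2).trans ?_⟩
  have : 1 ≤ Real.exp (-c) * Real.exp ζ.re := by
    rw [← Real.exp_add]; exact Real.one_le_exp (by linarith)
  calc C ≤ max C 0 := le_max_left _ _
    _ ≤ max C 0 * (Real.exp (-c) * Real.exp ζ.re) := le_mul_of_one_le_right (le_max_right _ _) this
    _ = _ := by ring

theorem Admissible.exp_smul {F : ℂ → E} {θ : ℝ} (hF : ContinuousOn F {ζ | |ζ.im| ≤ θ})
    {C : ℝ} (hC : ∀ ζ : ℂ, |ζ.im| ≤ θ → ‖F ζ‖ ≤ C) (c : ℝ) :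
    Admissible (fun ζ => Complex.exp ζ • F ζ) c θ := by
  refine ⟨Complex.continuous_exp.continuousOn.smul hF, C, fun ζ _ h2 => ?_⟩
  rw [norm_smul, Complex.norm_exp, mul_comm]
  gcongr
  exact hC ζ h2

theorem continuous_ray {F : ℂ → E} {θ y : ℝ} (hF : ContinuousOn F {ζ | |ζ.im| ≤ θ})
    (hy : |y| ≤ θ) : Continuous fun s : ℝ => F (s + y * Complex.I) := by
  rw [← continuousOn_univ]
  exact hF.comp (by fun_prop) fun s _ => by simpa using hy

theorem continuousOn_seg {F : ℂ → E} {θ : ℝ} (hF : ContinuousOn F {ζ | |ζ.im| ≤ θ}) (c : ℝ) :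
    ContinuousOn (fun y : ℝ => F (c + y * Complex.I)) (Set.Icc (-θ) θ) :=
  hF.comp (by fun_prop) fun y hy => by simpa [abs_le] using hy

theorem Admissible.norm_ray_le {F : ℂ → E} {c θ : ℝ} (hF : Admissible F c θ) {κ : ℝ}
    (hκ : 0 < κ) :
    ∃ C, ∀ (z : ℂ) (y : ℝ), |y| ≤ θ → (z * Complex.exp (y * Complex.I)).re ≤ -κ → ∀ s : ℝ, c ≤ s →
      ‖Complex.exp (z * Complex.exp (s + y * Complex.I)) • F (s + y * Complex.I)‖ ≤
        C * Real.exp (-1 * s) := by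
  obtain ⟨C, hC⟩ := hF.bound
  refine ⟨2 / κ ^ 2 * C, fun z y hy h s hs => ?_⟩
  rw [norm_smul]
  have h1 := norm_kernel_le hκ h s
  have h2 := hC (s + y * Complex.I) (by simpa using hs) (by simpa using hy)
  have h3 : ((s : ℂ) + y * Complex.I).re = s := by simp
  rw [h3] at h2
  calc _ ≤ (2 / κ ^ 2 * Real.exp (-2 * s)) * (C * Real.exp s) := by gcongr
    _ = 2 / κ ^ 2 * C * (Real.exp (-2 * s) * Real.exp s) := by ring
    _ = _ := by rw [← Real.exp_add]; ring_nf

theorem Admissible.integrableOn_ray {F : ℂ → E} {c θ : ℝ} (hF : Admissible F c θ) {z : ℂ}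
    {y : ℝ} (hy : |y| ≤ θ) (hz : (z * Complex.exp (y * Complex.I)).re < 0) :
    IntegrableOn (fun s : ℝ =>
      Complex.exp (z * Complex.exp (s + y * Complex.I)) • F (s + y * Complex.I)) (Set.Ioi c) := by
  obtain ⟨C, hC⟩ := hF.norm_ray_le (neg_pos.2 hz)
  refine Integrable.mono' ((integrableOn_exp_mul_Ioi (neg_one_lt_zero) c).const_mul C) ?_ ?_
  · exact (Continuous.smul (by fun_prop) (continuous_ray hF.cont hy)).aestronglyMeasurable
  · filter_upwards [ae_restrict_mem measurableSet_Ioi] with s hs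
    exact hC z y hy (by simp) s (le_of_lt hs)

theorem intervalIntegrable_seg {F : ℂ → E} {θ : ℝ} (hF : ContinuousOn F {ζ | |ζ.im| ≤ θ})
    (z : ℂ) (c : ℝ) {a b : ℝ} (ha : |a| ≤ θ) (hb : |b| ≤ θ) :
    IntervalIntegrable (fun y : ℝ =>
      Complex.exp (z * Complex.exp (c + y * Complex.I)) • F (c + y * Complex.I)) volume a b := by
  refine ContinuousOn.intervalIntegrable ?_
  refine ContinuousOn.smul (by fun_prop) ((continuousOn_seg hF c).mono ?_)
  exact Set.uIcc_subset_Icc (abs_le.1 ha) (abs_le.1 hb)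

/-- The exponential `exp (z λ)` decays along the rays of argument `±θ`. -/
def Decays (z : ℂ) (θ : ℝ) : Prop :=
  (z * Complex.exp (θ * Complex.I)).re < 0 ∧
    (z * Complex.exp ((-θ : ℝ) * Complex.I)).re < 0

theorem isOpen_decays (θ : ℝ) : IsOpen {z | Decays z θ} := by
  have h : ∀ y : ℝ, IsOpen {z : ℂ | (z * Complex.exp (y * Complex.I)).re < 0} := fun y =>
    isOpen_lt (Complex.continuous_re.comp (by fun_prop)) continuous_const
  exact (h θ).inter (h (-θ))

theorem hankel_sub {F G : ℂ → E} {c θ : ℝ} (hθ : 0 ≤ θ) (hF : Admissible F c θ)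
    (hG : Admissible G c θ) {z : ℂ} (hz : Decays z θ) :
    hankel z (fun ζ => F ζ - G ζ) c θ = hankel z F c θ - hankel z G c θ := by
  have a1 : |θ| ≤ θ := (abs_of_nonneg hθ).le
  have a2 : |-θ| ≤ θ := by rwa [abs_neg]
  unfold hankel rayIntegral segIntegral
  simp only [smul_sub]
  rw [integral_sub (hF.integrableOn_ray a1 hz.1) (hG.integrableOn_ray a1 hz.1),
    integral_sub (hF.integrableOn_ray a2 hz.2) (hG.integrableOn_ray a2 hz.2),
    intervalIntegral.integral_sub (intervalIntegrable_seg hF.cont z c a2 a1)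
      (intervalIntegrable_seg hG.cont z c a2 a1)]
  module

theorem hankel_clm {E' : Type*} [NormedAddCommGroup E'] [NormedSpace ℂ E'] [CompleteSpace E]
    [CompleteSpace E'] (L : E →L[ℂ] E') {F : ℂ → E} {c θ : ℝ} (hθ : 0 ≤ θ)
    (hF : Admissible F c θ) {z : ℂ} (hz : Decays z θ) :
    hankel z (fun ζ => L (F ζ)) c θ = L (hankel z F c θ) := by
  have a1 : |θ| ≤ θ := (abs_of_nonneg hθ).le
  have a2 : |-θ| ≤ θ := by rwa [abs_neg]
  unfold hankel rayIntegral segIntegral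
  simp only [← map_smul L]
  rw [L.integral_comp_comm (hF.integrableOn_ray a1 hz.1),
    L.integral_comp_comm (hF.integrableOn_ray a2 hz.2),
    L.intervalIntegral_comp_comm (intervalIntegrable_seg hF.cont z c a2 a1)]
  simp

theorem hasDerivAt_kernel_smul (F : ℂ → E) (ζ z : ℂ) :
    HasDerivAt (fun z => Complex.exp (z * Complex.exp ζ) • F ζ)
      (Complex.exp (z * Complex.exp ζ) • Complex.exp ζ • F ζ) z := by
  have := (((hasDerivAt_id z).mul_const (Complex.exp ζ)).cexp).smul_const (F ζ)
  simpa [smul_smul] using this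

theorem hasDerivAt_rayIntegral {F : ℂ → E} {θ : ℝ} (hF : ContinuousOn F {ζ | |ζ.im| ≤ θ})
    {C : ℝ} (hC : ∀ ζ : ℂ, |ζ.im| ≤ θ → ‖F ζ‖ ≤ C) (c : ℝ) {y : ℝ} (hy : |y| ≤ θ) {z : ℂ}
    (hz : (z * Complex.exp (y * Complex.I)).re < 0) :
    HasDerivAt (fun z => rayIntegral z F c y)
      (rayIntegral z (fun ζ => Complex.exp ζ • F ζ) c y) z := by
  have hA := Admissible.of_bounded hF hC c
  have hA' := Admissible.exp_smul hF hC c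
  set κ : ℝ := -(z * Complex.exp (y * Complex.I)).re / 2 with hκ
  have hκ0 : 0 < κ := by linarith
  obtain ⟨D, hD⟩ := hA'.norm_ray_le hκ0
  have hs : {w : ℂ | (w * Complex.exp (y * Complex.I)).re < -κ} ∈ 𝓝 z := by
    refine IsOpen.mem_nhds (isOpen_lt (Complex.continuous_re.comp (by fun_prop))
      continuous_const) ?_
    rw [Set.mem_ofPred_eq]
    linarith
  refine (hasDerivAt_integral_of_dominated_loc_of_deriv_le (𝕜 := ℂ)
    (F := fun (z : ℂ) (s : ℝ) =>
      Complex.exp (z * Complex.exp (s + y * Complex.I)) • F (s + y * Complex.I))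
    (F' := fun (z : ℂ) (s : ℝ) => Complex.exp (z * Complex.exp (s + y * Complex.I)) •
      Complex.exp (s + y * Complex.I) • F (s + y * Complex.I)) hs ?_
    (hA.integrableOn_ray hy hz) ?_ (bound := fun s => D * Real.exp (-1 * s)) ?_
    ((integrableOn_exp_mul_Ioi (neg_one_lt_zero) c).const_mul D) ?_).2
  · exact .of_forall fun w =>
      (Continuous.smul (by fun_prop) (continuous_ray hF hy)).aestronglyMeasurable
  · exact (hA'.integrableOn_ray hy hz).aestronglyMeasurable
  · filter_upwards [ae_restrict_mem measurableSet_Ioi] with s hs w hw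
    exact hD w y hy (le_of_lt hw) s (le_of_lt hs)
  · exact .of_forall fun s w _ => hasDerivAt_kernel_smul F _ w

theorem hasDerivAt_segIntegral {F : ℂ → E} {θ : ℝ} (hF : ContinuousOn F {ζ | |ζ.im| ≤ θ})
    {C : ℝ} (hC : ∀ ζ : ℂ, |ζ.im| ≤ θ → ‖F ζ‖ ≤ C) (c : ℝ) {a b : ℝ} (ha : |a| ≤ θ)
    (hb : |b| ≤ θ) (z : ℂ) :
    HasDerivAt (fun z => segIntegral z F c a b)
      (segIntegral z (fun ζ => Complex.exp ζ • F ζ) c a b) z := by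
  have hF' : ContinuousOn (fun ζ => Complex.exp ζ • F ζ) {ζ | |ζ.im| ≤ θ} :=
    Complex.continuous_exp.continuousOn.smul hF
  refine (intervalIntegral.hasDerivAt_integral_of_dominated_loc_of_deriv_le (𝕜 := ℂ)
    (F := fun (z : ℂ) (y : ℝ) =>
      Complex.exp (z * Complex.exp (c + y * Complex.I)) • F (c + y * Complex.I))
    (F' := fun (z : ℂ) (y : ℝ) => Complex.exp (z * Complex.exp (c + y * Complex.I)) •
      Complex.exp (c + y * Complex.I) • F (c + y * Complex.I))
    (Metric.ball_mem_nhds z one_pos) (.of_forall fun w => ?_)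
    (intervalIntegrable_seg hF z c ha hb) ?_
    (bound := fun _ => Real.exp ((‖z‖ + 1) * Real.exp c) * (Real.exp c * C)) ?_ ?_ ?_).2
  · exact (intervalIntegrable_iff.1 (intervalIntegrable_seg hF w c ha hb)).aestronglyMeasurable
  · exact (intervalIntegrable_iff.1 (intervalIntegrable_seg hF' z c ha hb)).aestronglyMeasurable
  · refine .of_forall fun y hy w hw => ?_
    have hy' : |y| ≤ θ := abs_le.2
      (Set.uIcc_subset_Icc (abs_le.1 ha) (abs_le.1 hb) (Set.uIoc_subset_uIcc hy))
    have hwn : ‖w‖ ≤ ‖z‖ + 1 := by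
      have := norm_sub_norm_le w z
      rw [Metric.mem_ball, dist_eq_norm] at hw
      linarith
    have he : ‖Complex.exp (c + y * Complex.I)‖ = Real.exp c := by simp [Complex.norm_exp]
    rw [norm_smul, norm_smul, he]
    gcongr
    · refine (Complex.norm_exp_le_exp_norm _).trans ?_
      rw [norm_mul, he]
      gcongr
    · exact hC _ (by simpa using hy')
  · exact intervalIntegrable_const
  · exact .of_forall fun s _ w _ => hasDerivAt_kernel_smul F _ w

theorem hasDerivAt_hankel {F : ℂ → E} {θ : ℝ} (hθ : 0 ≤ θ)
    (hF : ContinuousOn F {ζ | |ζ.im| ≤ θ})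
    {C : ℝ} (hC : ∀ ζ : ℂ, |ζ.im| ≤ θ → ‖F ζ‖ ≤ C) (c : ℝ) {z : ℂ} (hz : Decays z θ) :
    HasDerivAt (fun z => hankel z F c θ) (hankel z (fun ζ => Complex.exp ζ • F ζ) c θ) z := by
  have a1 : |θ| ≤ θ := (abs_of_nonneg hθ).le
  have a2 : |-θ| ≤ θ := by rwa [abs_neg]
  exact (((hasDerivAt_rayIntegral hF hC c a1 hz.1).sub
    (hasDerivAt_rayIntegral hF hC c a2 hz.2)).add
    ((hasDerivAt_segIntegral hF hC c a2 a1 z).const_smul Complex.I)).const_smul _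

/-- The size of the inverse Laplace integral over the contour adapted to `z`. -/
theorem norm_hankel_le {F : ℂ → E} {θ κ C : ℝ} (hθ : 0 ≤ θ) (hθπ : θ ≤ Real.pi) (hκ : 0 < κ)
    {z : ℂ} (hz : z ≠ 0)
    (hp : (z * Complex.exp (θ * Complex.I)).re ≤ -(‖z‖ * κ))
    (hm : (z * Complex.exp ((-θ : ℝ) * Complex.I)).re ≤ -(‖z‖ * κ))
    (hC0 : 0 ≤ C)
    (hC : ∀ ζ : ℂ, -Real.log ‖z‖ ≤ ζ.re → |ζ.im| ≤ θ → ‖F ζ‖ ≤ C) :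
    ‖hankel z F (-Real.log ‖z‖) θ‖ ≤ C * (Real.exp 1 + 1 / (Real.pi * κ)) := by
  have a1 : |θ| ≤ θ := (abs_of_nonneg hθ).le
  have a2 : |-θ| ≤ θ := by rwa [abs_neg]
  have hzn : 0 < ‖z‖ := norm_pos_iff.2 hz
  set c := -Real.log ‖z‖ with hc
  have hec : ‖z‖ * Real.exp c = 1 := by
    rw [hc, Real.exp_neg, Real.exp_log hzn, mul_inv_cancel₀ hzn.ne']
  have ray : ∀ y : ℝ, |y| ≤ θ → (z * Complex.exp (y * Complex.I)).re ≤ -(‖z‖ * κ) →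
      ‖rayIntegral z F c y‖ ≤ C / κ := by
    intro y hy h
    have hint : IntegrableOn (fun s : ℝ => C * Real.exp (κ * c) * Real.exp (-κ * s)) (Set.Ioi c) :=
      (integrableOn_exp_mul_Ioi (neg_neg_of_pos hκ) c).const_mul _
    refine (norm_integral_le_of_norm_le hint ?_).trans ?_
    · filter_upwards [ae_restrict_mem measurableSet_Ioi] with s hs
      rw [norm_smul, norm_kernel, mul_comm]
      have h1 : ‖F (s + y * Complex.I)‖ ≤ C :=
        hC _ (by simpa using le_of_lt hs) (by simpa using hy)
      have h2 : Real.exp s * (z * Complex.exp (y * Complex.I)).re ≤ κ * c + -κ * s := by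
        have h3 : Real.exp s * (z * Complex.exp (y * Complex.I)).re ≤
            Real.exp s * -(‖z‖ * κ) := by gcongr
        have h4 : ‖z‖ * Real.exp s = Real.exp (s - c) := by
          rw [show s = c + (s - c) by ring, Real.exp_add, ← mul_assoc, hec]; simp
        have h5 : s - c + 1 ≤ Real.exp (s - c) := Real.add_one_le_exp _
        have h6 : Real.exp s * -(‖z‖ * κ) = -κ * Real.exp (s - c) := by rw [← h4]; ring
        nlinarith
      rw [mul_assoc, ← Real.exp_add]
      gcongr
    · rw [integral_const_mul, integral_exp_mul_Ioi (neg_neg_of_pos hκ), neg_div_neg_eq,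
        mul_div_assoc', mul_assoc, ← Real.exp_add]
      simp
  have seg : ‖segIntegral z F c (-θ) θ‖ ≤ Real.exp 1 * C * (2 * Real.pi) := by
    refine (intervalIntegral.norm_integral_le_of_norm_le_const
      (C := Real.exp 1 * C) fun y hy => ?_).trans ?_
    · have hy' : |y| ≤ θ := abs_le.2
        (Set.uIcc_subset_Icc (abs_le.1 a2) (abs_le.1 a1) (Set.uIoc_subset_uIcc hy))
      rw [norm_smul]
      gcongr
      · refine (Complex.norm_exp_le_exp_norm _).trans ?_
        rw [norm_mul, show ‖Complex.exp (c + y * Complex.I)‖ = Real.exp c by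
          simp [Complex.norm_exp], hec]
      · exact hC _ (by simp) (by simpa using hy')
    · gcongr
      rw [abs_of_nonneg (by linarith)]; linarith
  have hpi := Real.pi_pos
  unfold hankel
  rw [norm_smul]
  have hn : ‖(2 * Real.pi * Complex.I : ℂ)⁻¹‖ = (2 * Real.pi)⁻¹ := by
    simp [abs_of_pos hpi]
  rw [hn]
  calc (2 * Real.pi)⁻¹ * ‖rayIntegral z F c θ - rayIntegral z F c (-θ) +
        Complex.I • segIntegral z F c (-θ) θ‖
      ≤ (2 * Real.pi)⁻¹ * ((C / κ + C / κ) + Real.exp 1 * C * (2 * Real.pi)) := by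
        gcongr
        refine (norm_add_le _ _).trans (add_le_add ((norm_sub_le _ _).trans
          (add_le_add (ray θ a1 hp) (ray (-θ) a2 hm))) ?_)
        rw [norm_smul, Complex.norm_I, one_mul]
        exact seg
    _ = _ := by field_simp; ring

theorem differentiableOn_kernel_smul {F : ℂ → E} {S : Set ℂ} (hF : DifferentiableOn ℂ F S)
    (z : ℂ) : DifferentiableOn ℂ (fun ζ => Complex.exp (z * Complex.exp ζ) • F ζ) S :=
  DifferentiableOn.smul (Differentiable.differentiableOn (by fun_prop)) hF

theorem hankel_eq_of_abscissa [CompleteSpace E] {F : ℂ → E} {θ C : ℝ} (hθ : 0 ≤ θ)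
    (hF : DifferentiableOn ℂ F {ζ | |ζ.im| ≤ θ}) (hC : ∀ ζ : ℂ, |ζ.im| ≤ θ → ‖F ζ‖ ≤ C)
    {z : ℂ} (hz : Decays z θ) (c c' : ℝ) : hankel z F c θ = hankel z F c' θ := by
  have a1 : |θ| ≤ θ := (abs_of_nonneg hθ).le
  have a2 : |-θ| ≤ θ := by rwa [abs_neg]
  have hA := fun c => Admissible.of_bounded hF.continuousOn hC c
  have h1 := intervalIntegral.integral_Ioi_sub_Ioi' ((hA c).integrableOn_ray a1 hz.1)
    ((hA c').integrableOn_ray a1 hz.1)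
  have h2 := intervalIntegral.integral_Ioi_sub_Ioi' ((hA c).integrableOn_ray a2 hz.2)
    ((hA c').integrableOn_ray a2 hz.2)
  have h3 := Complex.integral_boundary_rect_eq_zero_of_differentiableOn
    (fun ζ => Complex.exp (z * Complex.exp ζ) • F ζ) ⟨c, -θ⟩ ⟨c', θ⟩
    ((differentiableOn_kernel_smul hF z).mono fun ζ hζ => by
      have := hζ.2
      simp only [Set.mem_preimage, Set.uIcc_of_le (neg_le_self hθ)] at this
      exact abs_le.2 this)
  simp only [← h1, ← h2] at h3
  unfold hankel
  congr 1
  rw [← sub_eq_zero, ← neg_eq_zero, ← h3]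
  unfold rayIntegral segIntegral
  module

theorem rayIntegral_sub_rayIntegral [CompleteSpace E] {F : ℂ → E} {θ C : ℝ}
    (hF : DifferentiableOn ℂ F {ζ | |ζ.im| ≤ θ}) (hC : ∀ ζ : ℂ, |ζ.im| ≤ θ → ‖F ζ‖ ≤ C)
    {z : ℂ} {a b : ℝ} (hab : a ≤ b) (ha : |a| ≤ θ) (hb : |b| ≤ θ)
    (hz : ∀ y : ℝ, y ∈ Set.Icc a b → (z * Complex.exp (y * Complex.I)).re < 0) (c : ℝ) :
    rayIntegral z F c b - rayIntegral z F c a + Complex.I • segIntegral z F c a b = 0 := by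
  have hsub : ∀ y ∈ Set.Icc a b, |y| ≤ θ := fun y hy =>
    abs_le.2 ⟨(abs_le.1 ha).1.trans hy.1, hy.2.trans (abs_le.1 hb).2⟩
  have hA := Admissible.of_bounded hF.continuousOn hC c
  obtain ⟨y₀, hy₀, hmax⟩ := isCompact_Icc.exists_isMaxOn (Set.nonempty_Icc.2 hab)
    (f := fun y : ℝ => (z * Complex.exp (y * Complex.I)).re)
    (Complex.continuous_re.comp (by fun_prop)).continuousOn
  obtain ⟨D, hD⟩ := hA.norm_ray_le (neg_pos.2 (hz y₀ hy₀))
  have hlim : Tendsto (fun N : ℝ => segIntegral z F N a b) atTop (𝓝 0) := by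
    have hb0 : Tendsto (fun N : ℝ => D * Real.exp (-1 * N) * |b - a|) atTop (𝓝 0) := by
      have : Tendsto (fun N : ℝ => Real.exp (-1 * N)) atTop (𝓝 0) := by
        simpa using Real.tendsto_exp_neg_atTop_nhds_zero
      simpa using (this.const_mul D).mul_const |b - a|
    refine squeeze_zero_norm' ?_ hb0
    filter_upwards [eventually_ge_atTop c] with N hN
    refine intervalIntegral.norm_integral_le_of_norm_le_const fun y hy => ?_
    have hy' : y ∈ Set.Icc a b := by
      rw [← Set.uIcc_of_le hab]; exact Set.uIoc_subset_uIcc hy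
    exact hD z y (hsub y hy') (by rw [neg_neg]; exact hmax hy') N hN
  have hra := intervalIntegral_tendsto_integral_Ioi c
    (hA.integrableOn_ray ha (hz a (Set.left_mem_Icc.2 hab))) tendsto_id
  have hrb := intervalIntegral_tendsto_integral_Ioi c
    (hA.integrableOn_ray hb (hz b (Set.right_mem_Icc.2 hab))) tendsto_id
  have key := (((hra.sub hrb).add (hlim.const_smul Complex.I)).sub
    (tendsto_const_nhds (x := Complex.I • segIntegral z F c a b)))
  have h0 : ∀ N : ℝ, _ = (0 : E) := fun N =>
    Complex.integral_boundary_rect_eq_zero_of_differentiableOn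
    (fun ζ => Complex.exp (z * Complex.exp ζ) • F ζ) ⟨c, a⟩ ⟨N, b⟩
    ((differentiableOn_kernel_smul hF z).mono fun ζ hζ => by
      have := hζ.2
      simp only [Set.mem_preimage, Set.uIcc_of_le hab] at this
      exact hsub _ this)
  have h1 := tendsto_nhds_unique key ((tendsto_congr h0).2 tendsto_const_nhds)
  rw [smul_zero, add_zero] at h1
  rw [← neg_eq_zero, ← h1]
  unfold rayIntegral
  module

theorem hankel_eq_of_angle [CompleteSpace E] {F : ℂ → E} {θ θ' C : ℝ} (hθ : 0 ≤ θ) (hle : θ ≤ θ')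
    (hF : DifferentiableOn ℂ F {ζ | |ζ.im| ≤ θ'}) (hC : ∀ ζ : ℂ, |ζ.im| ≤ θ' → ‖F ζ‖ ≤ C)
    {z : ℂ} (hz : ∀ y ∈ Set.Icc θ θ', Decays z y) (c : ℝ) :
    hankel z F c θ = hankel z F c θ' := by
  have a1 : |θ| ≤ θ' := by rwa [abs_of_nonneg hθ]
  have a2 : |-θ| ≤ θ' := by rwa [abs_neg]
  have a3 : |θ'| ≤ θ' := (abs_of_nonneg (hθ.trans hle)).le
  have a4 : |-θ'| ≤ θ' := by rwa [abs_neg]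
  have h1 := rayIntegral_sub_rayIntegral hF hC hle a1 a3 (fun y hy => (hz y hy).1) c
  have h2 := rayIntegral_sub_rayIntegral hF hC (neg_le_neg hle) a4 a2 (fun y hy => by
    have := (hz (-y) ⟨by linarith [hy.2], by linarith [hy.1]⟩).2
    rwa [neg_neg] at this) c
  have i1 := intervalIntegrable_seg hF.continuousOn z c a4 a2
  have i2 := intervalIntegrable_seg hF.continuousOn z c a2 a1
  have i3 := intervalIntegrable_seg hF.continuousOn z c a1 a3
  have h3 : segIntegral z F c (-θ') θ' =
      segIntegral z F c (-θ') (-θ) + segIntegral z F c (-θ) θ + segIntegral z F c θ θ' := by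
    unfold segIntegral
    rw [intervalIntegral.integral_add_adjacent_intervals i1 i2,
      intervalIntegral.integral_add_adjacent_intervals (i1.trans i2) i3]
  unfold hankel
  congr 1
  rw [h3, ← sub_eq_zero, ← neg_eq_zero]
  calc _ = (rayIntegral z F c θ' - rayIntegral z F c θ + Complex.I • segIntegral z F c θ θ') +
        (rayIntegral z F c (-θ) - rayIntegral z F c (-θ') +
          Complex.I • segIntegral z F c (-θ') (-θ)) := by module
    _ = 0 := by rw [h1, h2, add_zero]

theorem exp_angle_re (z : ℂ) (y : ℝ) :
    (z * Complex.exp (y * Complex.I)).re = ‖z‖ * Real.cos (Complex.arg z + y) := by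
  conv_lhs => rw [← Complex.norm_mul_exp_arg_mul_I z]
  rw [mul_assoc, ← Complex.exp_add, Complex.re_ofReal_mul, ← add_mul, ← Complex.ofReal_add,
    Complex.exp_ofReal_mul_I_re]

theorem decays_of_arg {z : ℂ} (hz : z ≠ 0) {θ : ℝ} (h1 : Real.pi / 2 + |Complex.arg z| < θ)
    (h2 : θ + |Complex.arg z| < 3 * Real.pi / 2) : Decays z θ := by
  have hn : 0 < ‖z‖ := norm_pos_iff.2 hz
  have := le_abs_self (Complex.arg z)
  have := neg_abs_le (Complex.arg z)
  constructor
  · rw [exp_angle_re]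
    exact mul_neg_of_pos_of_neg hn (Real.cos_neg_of_pi_div_two_lt_of_lt (by linarith) (by linarith))
  · rw [exp_angle_re, ← Real.cos_neg]
    exact mul_neg_of_pos_of_neg hn (Real.cos_neg_of_pi_div_two_lt_of_lt (by linarith) (by linarith))

/-- The inverse Laplace transform of `1/λ` is `1`. -/
theorem hankel_one {z : ℂ} (hz : z ≠ 0) {θ : ℝ} (h1 : Real.pi / 2 + |Complex.arg z| < θ)
    (h2 : θ ≤ Real.pi) (c : ℝ) : hankel z (fun _ => (1 : ℂ)) c θ = 1 := by
  have hpi := Real.pi_pos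
  have habs := abs_nonneg (Complex.arg z)
  rw [hankel_eq_of_angle (C := 1) (by linarith) h2 (differentiableOn_const _) (by simp)
    (fun y hy => decays_of_arg hz (h1.trans_le hy.1) (by linarith [hy.2])) c]
  have hray : rayIntegral z (fun _ => (1 : ℂ)) c Real.pi =
      rayIntegral z (fun _ => (1 : ℂ)) c (-Real.pi) := by
    unfold rayIntegral
    congr 1
    ext s
    have : (s : ℂ) + (Real.pi : ℝ) * Complex.I =
      s + ((-Real.pi : ℝ) : ℂ) * Complex.I + 2 * Real.pi * Complex.I := by push_cast; ring
    rw [this, Complex.exp_periodic]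
  have hseg : segIntegral z (fun _ => (1 : ℂ)) c (-Real.pi) Real.pi = 2 * Real.pi := by
    have h3 : Real.circleAverage (fun w => Complex.exp (z * w)) 0 (Real.exp c) = 1 := by
      rw [DiffContOnCl.circleAverage]
      · simp
      · exact (Differentiable.diffContOnCl (by fun_prop))
    rw [Real.circleAverage_def] at h3
    have h4 : Function.Periodic
        (fun y : ℝ => Complex.exp (z * circleMap 0 (Real.exp c) y)) (2 * Real.pi) := fun y => by
      simp only [periodic_circleMap 0 (Real.exp c) y]
    have h5 := h4.intervalIntegral_add_eq 0 (-Real.pi)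
    rw [zero_add, show -Real.pi + 2 * Real.pi = Real.pi by ring] at h5
    rw [h5, inv_smul_eq_iff₀ (by positivity)] at h3
    have h6 : segIntegral z (fun _ => (1 : ℂ)) c (-Real.pi) Real.pi =
        ∫ y in (-Real.pi)..Real.pi, Complex.exp (z * circleMap 0 (Real.exp c) y) := by
      unfold segIntegral
      simp [circleMap, Complex.exp_add]
    rw [h6, h3]
    simp
  unfold hankel
  rw [hray, hseg, sub_self, zero_add, smul_eq_mul, smul_eq_mul]
  have : (Real.pi : ℂ) ≠ 0 := by exact_mod_cast hpi.ne'
  have := Complex.I_ne_zero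
  field_simp

theorem mem_sector_iff_decays {α : ℝ} (hα : 0 < α) (hα' : α ≤ Real.pi / 2) {z : ℂ} :
    z ∈ sector α ↔ Decays z (α + Real.pi / 2) := by
  constructor
  · rintro ⟨h0, h1⟩
    exact decays_of_arg h0 (by linarith) (by linarith)
  · rintro ⟨h1, h2⟩
    have hz : z ≠ 0 := by rintro rfl; simp at h1
    have hn : 0 < ‖z‖ := norm_pos_iff.2 hz
    rw [exp_angle_re] at h1 h2
    have h1' := neg_of_mul_neg_right h1 hn.le
    have h2' := neg_of_mul_neg_right h2 hn.le
    have := Complex.neg_pi_lt_arg z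
    have := Complex.arg_le_pi z
    refine ⟨hz, abs_lt.2 ⟨?_, ?_⟩⟩ <;> by_contra! h
    · exact h1'.not_ge (Real.cos_nonneg_of_neg_pi_div_two_le_of_le (by linarith) (by linarith))
    · exact h2'.not_ge (Real.cos_nonneg_of_neg_pi_div_two_le_of_le (by linarith) (by linarith))

theorem sector_mem_nhds {α : ℝ} (hα : 0 < α) (hα' : α ≤ Real.pi / 2) {z : ℂ}
    (hz : z ∈ sector α) : sector α ∈ 𝓝 z := by
  have : sector α = {z | Decays z (α + Real.pi / 2)} :=
    Set.ext fun _ => mem_sector_iff_decays hα hα'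
  rw [this] at hz ⊢
  exact (isOpen_decays _).mem_nhds hz

theorem add_mem_sector {α : ℝ} (hα : 0 < α) (hα' : α ≤ Real.pi / 2) {z w : ℂ}
    (hz : z ∈ sector α) (hw : w ∈ sector α) : z + w ∈ sector α := by
  rw [mem_sector_iff_decays hα hα'] at *
  constructor
  · rw [add_mul, Complex.add_re]; exact add_neg hz.1 hw.1
  · rw [add_mul, Complex.add_re]; exact add_neg hz.2 hw.2

theorem ofReal_mul_mem_sector {α : ℝ} {z : ℂ} (hz : z ∈ sector α) {r : ℝ} (hr : 0 < r) :
    (r : ℂ) * z ∈ sector α :=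
  ⟨mul_ne_zero (by exact_mod_cast hr.ne') hz.1, by rw [Complex.arg_real_mul _ hr]; exact hz.2⟩

theorem ofReal_mem_sector {α : ℝ} (hα : 0 < α) {r : ℝ} (hr : 0 < r) : (r : ℂ) ∈ sector α :=
  ⟨by exact_mod_cast hr.ne', by rwa [Complex.arg_ofReal_of_nonneg hr.le, abs_zero]⟩

theorem hankel_congr {F G : ℂ → E} {θ : ℝ} (hθ : 0 ≤ θ)
    (h : ∀ ζ : ℂ, |ζ.im| ≤ θ → F ζ = G ζ) (z : ℂ) (c : ℝ) :
    hankel z F c θ = hankel z G c θ := by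
  have a1 : |θ| ≤ θ := (abs_of_nonneg hθ).le
  have a2 : |-θ| ≤ θ := by rwa [abs_neg]
  have hray : ∀ y : ℝ, |y| ≤ θ → rayIntegral z F c y = rayIntegral z G c y := fun y hy => by
    unfold rayIntegral
    congr 1
    ext s
    rw [h _ (by simpa using hy)]
  have hseg : segIntegral z F c (-θ) θ = segIntegral z G c (-θ) θ := by
    refine intervalIntegral.integral_congr fun y hy => ?_
    rw [Set.uIcc_of_le (neg_le_self hθ)] at hy
    rw [h _ (by simpa using abs_le.2 hy)]
  unfold hankel
  rw [hray θ a1, hray (-θ) a2, hseg]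

/-- The holomorphic function on `Σ_α` with Laplace transform `F(log λ) / λ`. -/
noncomputable def invLaplace (F : ℂ → E) (α : ℝ) (z : ℂ) : E :=
  hankel z F 0 (Real.pi / 2 + (α + |Complex.arg z|) / 2)

section

variable [CompleteSpace E] {F : ℂ → E} {α M : ℝ}

theorem invLaplace_eq_hankel (hα' : α ≤ Real.pi / 2)
    (hF : DifferentiableOn ℂ F {ζ | |ζ.im| < α + Real.pi / 2})
    (hM : ∀ ζ : ℂ, |ζ.im| < α + Real.pi / 2 → ‖F ζ‖ ≤ M) {z : ℂ} (hz : z ≠ 0) {θ : ℝ}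
    (h1 : Real.pi / 2 + |Complex.arg z| < θ) (h2 : θ < α + Real.pi / 2) (c : ℝ) :
    invLaplace F α z = hankel z F c θ := by
  have hpi := Real.pi_pos
  have habs := abs_nonneg (Complex.arg z)
  set θ₀ := Real.pi / 2 + (α + |Complex.arg z|) / 2 with hθ₀
  have hF' : ∀ φ, φ < α + Real.pi / 2 → DifferentiableOn ℂ F {ζ | |ζ.im| ≤ φ} := fun φ hφ =>
    hF.mono fun ζ hζ => lt_of_le_of_lt hζ hφ
  have hM' : ∀ φ, φ < α + Real.pi / 2 → ∀ ζ : ℂ, |ζ.im| ≤ φ → ‖F ζ‖ ≤ M := fun φ hφ ζ hζ =>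
    hM ζ (hζ.trans_lt hφ)
  have hθ₀' : θ₀ < α + Real.pi / 2 := by linarith
  have hdec : ∀ y, Real.pi / 2 + |Complex.arg z| < y → y < α + Real.pi / 2 → Decays z y :=
    fun y hy hy' => decays_of_arg hz hy (by linarith)
  rw [← hankel_eq_of_abscissa (by linarith) (hF' θ h2) (hM' θ h2) (hdec θ h1 h2) 0 c]
  rcases le_total θ θ₀ with h | h
  · exact (hankel_eq_of_angle (by linarith) h (hF' _ hθ₀') (hM' _ hθ₀')
      (fun y hy => hdec y (h1.trans_le hy.1) (hy.2.trans_lt hθ₀')) 0).symm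
  · exact hankel_eq_of_angle (by linarith) h (hF' _ h2) (hM' _ h2)
      (fun y hy => hdec y (lt_of_lt_of_le (by linarith) hy.1) (hy.2.trans_lt h2)) 0

theorem hasDerivAt_invLaplace (hα' : α ≤ Real.pi / 2)
    (hF : DifferentiableOn ℂ F {ζ | |ζ.im| < α + Real.pi / 2})
    (hM : ∀ ζ : ℂ, |ζ.im| < α + Real.pi / 2 → ‖F ζ‖ ≤ M) {z : ℂ} (hz : z ≠ 0) {θ : ℝ}
    (h1 : Real.pi / 2 + |Complex.arg z| < θ) (h2 : θ < α + Real.pi / 2) :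
    HasDerivAt (invLaplace F α) (hankel z (fun ζ => Complex.exp ζ • F ζ) 0 θ) z := by
  have hpi := Real.pi_pos
  have habs := abs_nonneg (Complex.arg z)
  refine (hasDerivAt_hankel (by linarith)
    (hF.continuousOn.mono fun ζ hζ => lt_of_le_of_lt hζ h2) (C := M)
    (fun ζ hζ => hM ζ (hζ.trans_lt h2)) 0 (decays_of_arg hz h1 (by linarith))).congr_of_eventuallyEq
    ?_
  filter_upwards [sector_mem_nhds (α := θ - Real.pi / 2) (by linarith) (by linarith)
    (show z ∈ sector (θ - Real.pi / 2) from ⟨hz, by linarith⟩)] with w hw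
  exact invLaplace_eq_hankel hα' hF hM hw.1 (by linarith [hw.2]) h2 0

end

/-- For `z ∈ Σ_{α - ε}` the contour with opening angle `π/2 + α - ε/2` is uniformly decaying. -/
theorem angle_estimate {α ε : ℝ} (hα' : α ≤ Real.pi / 2) (hε : 0 < ε) {z : ℂ}
    (hz : z ∈ sector (α - ε)) {y : ℝ}
    (hy : y = α + Real.pi / 2 - ε / 2 ∨ y = -(α + Real.pi / 2 - ε / 2)) :
    (z * Complex.exp (y * Complex.I)).re ≤ -(‖z‖ * Real.sin (ε / 2)) := by
  have hpi := Real.pi_pos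
  obtain ⟨h1, h2⟩ := abs_lt.1 hz.2
  have key : ∀ u, ε / 2 ≤ u → u ≤ Real.pi - ε / 2 → Real.sin (ε / 2) ≤ Real.sin u := by
    intro u hu hu'
    rcases le_total u (Real.pi / 2) with h | h
    · exact Real.sin_le_sin_of_le_of_le_pi_div_two (by linarith) h hu
    · rw [← Real.sin_pi_sub u]
      exact Real.sin_le_sin_of_le_of_le_pi_div_two (by linarith) (by linarith) (by linarith)
  rw [exp_angle_re, ← mul_neg]
  refine mul_le_mul_of_nonneg_left ?_ (norm_nonneg z)
  rcases hy with rfl | rfl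
  · have := key (Complex.arg z + α - ε / 2) (by linarith) (by linarith)
    rw [show Complex.arg z + (α + Real.pi / 2 - ε / 2) =
      (Complex.arg z + α - ε / 2) + Real.pi / 2 by ring, Real.cos_add_pi_div_two]
    linarith
  · have := key (-Complex.arg z + α - ε / 2) (by linarith) (by linarith)
    rw [← Real.cos_neg, show -(Complex.arg z + -(α + Real.pi / 2 - ε / 2)) =
      (-Complex.arg z + α - ε / 2) + Real.pi / 2 by ring, Real.cos_add_pi_div_two]
    linarith

theorem norm_invLaplace_le [CompleteSpace E] {F : ℂ → E} {α M ε : ℝ} (hM0 : 0 ≤ M)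
    (hα' : α ≤ Real.pi / 2) (hF : DifferentiableOn ℂ F {ζ | |ζ.im| < α + Real.pi / 2})
    (hM : ∀ ζ : ℂ, |ζ.im| < α + Real.pi / 2 → ‖F ζ‖ ≤ M) (hε : 0 < ε) (hεα : ε < α) {z : ℂ}
    (hz : z ∈ sector (α - ε)) :
    ‖invLaplace F α z‖ ≤ M * (Real.exp 1 + 1 / (Real.pi * Real.sin (ε / 2))) := by
  have hpi := Real.pi_pos
  have h2 := hz.2
  rw [invLaplace_eq_hankel hα' hF hM hz.1 (θ := α + Real.pi / 2 - ε / 2) (by linarith)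
    (by linarith) (-Real.log ‖z‖)]
  exact norm_hankel_le (by linarith) (by linarith)
    (Real.sin_pos_of_pos_of_lt_pi (by linarith) (by linarith)) hz.1
    (angle_estimate hα' hε hz (.inl rfl)) (angle_estimate hα' hε hz (.inr rfl)) hM0
    fun ζ _ hζ => hM ζ (by linarith)

theorem const_le {ε : ℝ} (hε : 0 < ε) (hε' : ε < Real.pi / 2) :
    Real.exp 1 + 1 / (Real.pi * Real.sin (ε / 2)) ≤
      1 + 2 * Real.exp 1 * Real.pi / Real.sin ε := by
  have hpi := Real.pi_gt_three
  have hs : 0 < Real.sin ε := Real.sin_pos_of_pos_of_lt_pi hε (by linarith)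
  have hs2 : 0 < Real.sin (ε / 2) := Real.sin_pos_of_pos_of_lt_pi (by linarith) (by linarith)
  have he := Real.add_one_le_exp 1
  have hle : Real.sin ε ≤ 2 * Real.sin (ε / 2) := by
    have := Real.sin_two_mul (ε / 2)
    rw [show 2 * (ε / 2) = ε by ring] at this
    rw [this]
    nlinarith [Real.cos_le_one (ε / 2)]
  have h1 : 1 / (Real.pi * Real.sin (ε / 2)) ≤ 1 / Real.sin ε := by
    refine one_div_le_one_div_of_le hs ?_
    nlinarith
  have h2 : Real.exp 1 ≤ Real.exp 1 / Real.sin ε :=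
    (le_div_iff₀ hs).2 (mul_le_of_le_one_right (by linarith) (Real.sin_le_one ε))
  calc _ ≤ Real.exp 1 / Real.sin ε + 1 / Real.sin ε := add_le_add h2 h1
    _ = (Real.exp 1 + 1) / Real.sin ε := by ring
    _ ≤ 2 * Real.exp 1 * Real.pi / Real.sin ε := by gcongr; nlinarith
    _ ≤ _ := by linarith

section LogResolvent

variable {X : Type*} [NormedAddCommGroup X] [NormedSpace ℂ X]

/-- `F ζ = λ R(λ)` with `λ = exp ζ`, where `R` is a pseudo-resolvent on `Σ_{α + π/2}` with
`‖λ R(λ)‖ ≤ M` and `R(μ) = S`. -/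
structure IsLogResolvent (F : ℂ → X →L[ℂ] X) (α M : ℝ) (μ : ℂ) (S : X →L[ℂ] X) : Prop where
  diff : DifferentiableOn ℂ F {ζ | |ζ.im| < α + Real.pi / 2}
  bound : ∀ ζ : ℂ, |ζ.im| < α + Real.pi / 2 → ‖F ζ‖ ≤ M
  comm : ∀ ζ : ℂ, |ζ.im| < α + Real.pi / 2 → F ζ * S = S * F ζ
  identity : ∀ ζ : ℂ, |ζ.im| < α + Real.pi / 2 →
    Complex.exp ζ • (F ζ * S) = μ • (F ζ * S) - (F ζ - Complex.exp ζ • S)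

variable [CompleteSpace X] {F : ℂ → X →L[ℂ] X} {α M : ℝ} {μ : ℂ} {S : X →L[ℂ] X}

theorem hankel_const {z : ℂ} (hz : z ≠ 0) {θ : ℝ} (h1 : Real.pi / 2 + |Complex.arg z| < θ)
    (h2 : θ ≤ Real.pi) (c : ℝ) (S : X →L[ℂ] X) : hankel z (fun _ => S) c θ = S := by
  have hpi := Real.pi_pos
  have habs := abs_nonneg (Complex.arg z)
  have := hankel_clm (ContinuousLinearMap.toSpanSingleton ℂ S) (by linarith)
    (Admissible.of_bounded (F := fun _ => (1 : ℂ)) (θ := θ) (C := 1) continuousOn_const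
      (by simp) c) (decays_of_arg hz h1 (by linarith))
  rw [hankel_one hz h1 h2] at this
  simpa using this

theorem hankel_exp_smul {z : ℂ} (hz : z ≠ 0) {θ : ℝ} (h1 : Real.pi / 2 + |Complex.arg z| < θ)
    (h2 : θ ≤ Real.pi) (c : ℝ) (S : X →L[ℂ] X) :
    hankel z (fun ζ => Complex.exp ζ • S) c θ = 0 := by
  have hpi := Real.pi_pos
  have habs := abs_nonneg (Complex.arg z)
  have hd := hasDerivAt_hankel (F := fun _ => S) (θ := θ) (C := ‖S‖) (by linarith)
    continuousOn_const (by simp) c (decays_of_arg hz h1 (by linarith))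
  refine hd.unique ((hasDerivAt_const z S).congr_of_eventuallyEq ?_)
  filter_upwards [sector_mem_nhds (α := θ - Real.pi / 2) (by linarith) (by linarith)
    (show z ∈ sector (θ - Real.pi / 2) from ⟨hz, by linarith⟩)] with w hw
  exact hankel_const hw.1 (by linarith [hw.2]) h2 c S

/-- Left multiplication by `S` as a bounded linear map. -/
noncomputable abbrev mulL (S : X →L[ℂ] X) : (X →L[ℂ] X) →L[ℂ] (X →L[ℂ] X) :=
  ContinuousLinearMap.mul ℂ (X →L[ℂ] X) S

/-- Right multiplication by `S` as a bounded linear map. -/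
noncomputable abbrev mulR (S : X →L[ℂ] X) : (X →L[ℂ] X) →L[ℂ] (X →L[ℂ] X) :=
  (ContinuousLinearMap.mul ℂ (X →L[ℂ] X)).flip S

theorem hasDerivAt_comp_ofReal {E : Type*} [NormedAddCommGroup E] [NormedSpace ℂ E] {f : ℂ → E}
    {f' : E} {t : ℝ} (hf : HasDerivAt f f' (t : ℂ)) : HasDerivAt (fun s : ℝ => f s) f' t := by
  simpa [Function.comp_def] using hf.scomp t Complex.ofRealCLM.hasDerivAt

namespace IsLogResolvent

theorem exists_hasDerivAt (h : IsLogResolvent F α M μ S) (hα' : α ≤ Real.pi / 2) {z : ℂ}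
    (hz : z ∈ sector α) : ∃ D : X →L[ℂ] X, HasDerivAt (invLaplace F α) D z ∧
      D * S = μ • (invLaplace F α z * S) - invLaplace F α z ∧
      S * D = μ • (S * invLaplace F α z) - invLaplace F α z ∧
      invLaplace F α z * S = S * invLaplace F α z := by
  have hpi := Real.pi_pos
  have habs := abs_nonneg (Complex.arg z)
  have hzα := hz.2
  set θ := Real.pi / 2 + (α + |Complex.arg z|) / 2 with hθ
  have h1 : Real.pi / 2 + |Complex.arg z| < θ := by linarith
  have h2 : θ < α + Real.pi / 2 := by linarith
  have h3 : θ ≤ Real.pi := by linarith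
  have h0 : 0 ≤ θ := by linarith
  have hdec : Decays z θ := decays_of_arg hz.1 h1 (by linarith)
  have hc : ContinuousOn F {ζ | |ζ.im| ≤ θ} :=
    h.diff.continuousOn.mono fun ζ hζ => lt_of_le_of_lt hζ h2
  have hb : ∀ ζ : ℂ, |ζ.im| ≤ θ → ‖F ζ‖ ≤ M := fun ζ hζ => h.bound ζ (hζ.trans_lt h2)
  have hA := Admissible.of_bounded hc hb 0
  have hA' := Admissible.exp_smul hc hb 0
  have hAS := Admissible.exp_smul (F := fun _ => S) (θ := θ) (C := ‖S‖) continuousOn_const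
    (by simp) 0
  have hT : invLaplace F α z = hankel z F 0 θ := rfl
  have hcomm : invLaplace F α z * S = S * invLaplace F α z := by
    have e1 := hankel_clm (mulR S) h0 hA hdec
    have e2 := hankel_clm (mulL S) h0 hA hdec
    rw [hT]
    refine e1.symm.trans (Eq.trans (hankel_congr h0 (fun ζ hζ => ?_) _ _) e2)
    exact h.comm ζ (hζ.trans_lt h2)
  have hDS : hankel z (fun ζ => Complex.exp ζ • F ζ) 0 θ * S =
      μ • (invLaplace F α z * S) - invLaplace F α z := by
    refine (hankel_clm (mulR S) h0 hA' hdec).symm.trans ?_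
    have e1 : hankel z (fun ζ => mulR S (Complex.exp ζ • F ζ)) 0 θ =
        hankel z (fun ζ => (μ • mulR S) (F ζ) - (F ζ - Complex.exp ζ • S)) 0 θ := by
      refine hankel_congr h0 (fun ζ hζ => ?_) _ _
      rw [map_smul]
      exact h.identity ζ (hζ.trans_lt h2)
    rw [e1, hankel_sub h0 (hA.clm _) (hA.sub hAS) hdec, hankel_sub h0 hA hAS hdec,
      hankel_exp_smul hz.1 h1 h3, sub_zero, hankel_clm (μ • mulR S) h0 hA hdec, hT]
    rfl
  have hcommD : hankel z (fun ζ => Complex.exp ζ • F ζ) 0 θ * S =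
      S * hankel z (fun ζ => Complex.exp ζ • F ζ) 0 θ := by
    have e1 := hankel_clm (mulR S) h0 hA' hdec
    have e2 := hankel_clm (mulL S) h0 hA' hdec
    refine e1.symm.trans (Eq.trans (hankel_congr h0 (fun ζ hζ => ?_) _ _) e2)
    rw [map_smul, map_smul]
    exact congrArg (Complex.exp ζ • ·) (h.comm ζ (hζ.trans_lt h2))
  refine ⟨_, hasDerivAt_invLaplace hα' h.diff h.bound hz.1 h1 h2, hDS, ?_, hcomm⟩
  rw [← hcommD, hDS, hcomm]

theorem norm_mul_sub_le (h : IsLogResolvent F α M μ S) (hα' : α ≤ Real.pi / 2) (hM : 0 ≤ M)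
    {ε : ℝ} (hε : 0 < ε) (hεα : ε < α) {z : ℂ} (hz : z ∈ sector (α - ε)) :
    ‖invLaplace F α z * S - S‖ ≤
      (‖z‖ * ((‖μ‖ * ‖S‖ + 1) * M)) * (Real.exp 1 + 1 / (Real.pi * Real.sin (ε / 2))) := by
  have hpi := Real.pi_pos
  have hzα := hz.2
  have habs := abs_nonneg (Complex.arg z)
  have hn : 0 < ‖z‖ := norm_pos_iff.2 hz.1
  set θ := α + Real.pi / 2 - ε / 2 with hθ
  have h1 : Real.pi / 2 + |Complex.arg z| < θ := by linarith
  have h2 : θ < α + Real.pi / 2 := by linarith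
  have h3 : θ ≤ Real.pi := by linarith
  have h0 : 0 ≤ θ := by linarith
  have hdec : Decays z θ := decays_of_arg hz.1 h1 (by linarith)
  set c := -Real.log ‖z‖ with hc
  have hA : Admissible F c θ := Admissible.of_bounded
    (h.diff.continuousOn.mono fun ζ hζ => lt_of_le_of_lt hζ h2)
    (fun ζ hζ => h.bound ζ (hζ.trans_lt h2)) c
  have hAS := Admissible.of_bounded (F := fun _ => S) (θ := θ) (C := ‖S‖) continuousOn_const
    (by simp) c
  have e1 : invLaplace F α z * S - S =
      hankel z (fun ζ => Complex.exp (-ζ) • (μ • (F ζ * S) - F ζ)) c θ := by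
    rw [invLaplace_eq_hankel hα' h.diff h.bound hz.1 h1 h2 c]
    conv_lhs => rw [← hankel_const hz.1 h1 h3 c S]
    refine (congrArg₂ (· - ·) ?_ rfl).trans ((hankel_sub h0 (hA.clm (mulR S)) hAS hdec).symm.trans
      (hankel_congr h0 (fun ζ hζ => ?_) _ _))
    · rw [hankel_const hz.1 h1 h3 c S]
      exact (hankel_clm (mulR S) h0 hA hdec).symm
    · have := h.identity ζ (hζ.trans_lt h2)
      have e2 : μ • (F ζ * S) - F ζ = Complex.exp ζ • (F ζ * S) - Complex.exp ζ • S := by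
        rw [this]; abel
      rw [e2, smul_sub, smul_smul, smul_smul, ← Complex.exp_add]
      simp
  rw [e1]
  refine norm_hankel_le h0 h3 (Real.sin_pos_of_pos_of_lt_pi (by linarith) (by linarith)) hz.1
    (angle_estimate hα' hε hz (.inl rfl)) (angle_estimate hα' hε hz (.inr rfl)) (by positivity)
    fun ζ hre him => ?_
  have hFM := h.bound ζ (him.trans_lt h2)
  rw [norm_smul, Complex.norm_exp]
  have h4 : Real.exp (-ζ).re ≤ ‖z‖ := by
    rw [← Real.exp_log hn]
    exact Real.exp_le_exp.2 (by simp only [Complex.neg_re]; linarith)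
  have h5 : ‖μ • (F ζ * S) - F ζ‖ ≤ (‖μ‖ * ‖S‖ + 1) * M := by
    calc _ ≤ ‖μ‖ * (‖F ζ‖ * ‖S‖) + ‖F ζ‖ := by
          refine (norm_sub_le _ _).trans ?_
          rw [norm_smul]
          gcongr
          exact norm_mul_le _ _
      _ = (‖μ‖ * ‖S‖ + 1) * ‖F ζ‖ := by ring
      _ ≤ _ := by gcongr
  gcongr

theorem tendsto_mul (h : IsLogResolvent F α M μ S) (hα' : α ≤ Real.pi / 2) (hM : 0 ≤ M)
    {ε : ℝ} (hε : 0 < ε) (hεα : ε < α) :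
    Tendsto (fun z => invLaplace F α z * S) (𝓝[sector (α - ε)] 0) (𝓝 S) := by
  rw [tendsto_iff_norm_sub_tendsto_zero]
  have h0 : Tendsto (fun z : ℂ => (‖z‖ * ((‖μ‖ * ‖S‖ + 1) * M)) *
      (Real.exp 1 + 1 / (Real.pi * Real.sin (ε / 2)))) (𝓝[sector (α - ε)] 0) (𝓝 0) := by
    have : Tendsto (fun z : ℂ => ‖z‖) (𝓝[sector (α - ε)] 0) (𝓝 0) :=
      tendsto_norm_zero.mono_left nhdsWithin_le_nhds
    simpa using (this.mul_const ((‖μ‖ * ‖S‖ + 1) * M)).mul_const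
      (Real.exp 1 + 1 / (Real.pi * Real.sin (ε / 2)))
  refine squeeze_zero' (.of_forall fun _ => norm_nonneg _) ?_ h0
  filter_upwards [self_mem_nhdsWithin] with z hz
  exact h.norm_mul_sub_le hα' hM hε hεα hz

theorem invLaplace_add (h : IsLogResolvent F α M μ S) (hα : 0 < α) (hα' : α ≤ Real.pi / 2)
    (hM : 0 ≤ M) {z₁ z₂ : ℂ} (hz₁ : z₁ ∈ sector α) (hz₂ : z₂ ∈ sector α) :
    invLaplace F α (z₁ + z₂) = invLaplace F α z₁ * invLaplace F α z₂ := by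
  set T := invLaplace F α with hT
  have hl : ∀ s : ℝ, s < 1 → ((1 - s : ℝ) : ℂ) * z₁ ∈ sector α := fun s hs =>
    ofReal_mul_mem_sector hz₁ (by linarith)
  have hr : ∀ s : ℝ, 0 ≤ s → z₂ + (s : ℂ) * z₁ ∈ sector α := fun s hs => by
    rcases hs.eq_or_lt with rfl | hs
    · simpa using hz₂
    · exact add_mem_sector hα hα' hz₂ (ofReal_mul_mem_sector hz₁ hs)
  have hder : ∀ s : ℝ, 0 ≤ s → s < 1 → HasDerivAt
      (fun s : ℝ => T (((1 - s : ℝ) : ℂ) * z₁) * T (z₂ + (s : ℂ) * z₁)) 0 s := by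
    intro s hs hs1
    obtain ⟨D, hD, hDS, -, -⟩ := h.exists_hasDerivAt hα' (hl s hs1)
    obtain ⟨D', hD', -, hSD', -⟩ := h.exists_hasDerivAt hα' (hr s hs)
    have i1 : HasDerivAt (fun s : ℝ => ((1 - s : ℝ) : ℂ) * z₁) (-z₁) s := by
      have := (((hasDerivAt_id s).const_sub 1).ofReal_comp).mul_const z₁
      simpa using this
    have i2 : HasDerivAt (fun s : ℝ => z₂ + (s : ℂ) * z₁) z₁ s := by
      have := (((hasDerivAt_id s).ofReal_comp).mul_const z₁).const_add z₂
      simpa using this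
    have j1 := hD.scomp s i1
    have j2 := hD'.scomp s i2
    have := j1.mul j2
    refine this.congr_deriv ?_
    rw [← hT] at hDS hSD'
    set A := T (((1 - s : ℝ) : ℂ) * z₁)
    set B := T (z₂ + (s : ℂ) * z₁)
    have hB : B = S * (μ • B - D') := by
      rw [mul_sub, hSD', mul_smul_comm]; abel
    have key : D * B = A * D' := by
      calc D * B = (D * S) * (μ • B - D') := by rw [mul_assoc, ← hB]
        _ = μ • (A * (S * (μ • B - D'))) - A * (μ • B - D') := by
          rw [hDS, sub_mul, smul_mul_assoc, mul_assoc]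
        _ = A * D' := by rw [← hB, mul_sub, mul_smul_comm]; abel
    change (-z₁ • D) * B + A * (z₁ • D') = 0
    rw [smul_mul_assoc, mul_smul_comm, key, neg_smul, neg_add_cancel]
  have hconst : ∀ s : ℝ, 0 ≤ s → s < 1 →
      T (((1 - s : ℝ) : ℂ) * z₁) * T (z₂ + (s : ℂ) * z₁) = T z₁ * T z₂ := by
    intro s hs hs1
    have := constant_of_has_deriv_right_zero (a := 0) (b := s)
      (fun r hr => (hder r hr.1 (hr.2.trans_lt hs1)).continuousAt.continuousWithinAt)
      (fun r hr => (hder r hr.1 (hr.2.trans hs1)).hasDerivWithinAt) s ⟨hs, le_rfl⟩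
    simpa using this
  set ε := (α - |Complex.arg z₁|) / 2 with hεdef
  have hε : 0 < ε := by have := hz₁.2; linarith
  have hεα : ε < α := by have := abs_nonneg (Complex.arg z₁); linarith
  have hz₁' : z₁ ∈ sector (α - ε) := ⟨hz₁.1, by have := hz₁.2; linarith⟩
  have hev : ∀ᶠ s : ℝ in 𝓝[<] 1, 0 ≤ s ∧ s < 1 := by
    filter_upwards [self_mem_nhdsWithin, mem_nhdsWithin_of_mem_nhds (Ici_mem_nhds one_pos)]
      with s hs hs'
    exact ⟨hs', hs⟩
  have hto : Tendsto (fun s : ℝ => ((1 - s : ℝ) : ℂ) * z₁) (𝓝[<] 1) (𝓝[sector (α - ε)] 0) := by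
    refine tendsto_nhdsWithin_iff.2 ⟨?_, ?_⟩
    · have : Continuous fun s : ℝ => ((1 - s : ℝ) : ℂ) * z₁ := by fun_prop
      simpa using (this.tendsto 1).mono_left nhdsWithin_le_nhds
    · filter_upwards [hev] with s hs
      exact ofReal_mul_mem_sector hz₁' (by linarith [hs.2])
  obtain ⟨D, hD, -, hSD, -⟩ := h.exists_hasDerivAt hα' (add_mem_sector hα hα' hz₁ hz₂)
  rw [← hT] at hD hSD
  have hB : S * (μ • T (z₁ + z₂) - D) = T (z₁ + z₂) := by
    rw [mul_sub, hSD, mul_smul_comm]; abel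
  have l1 : Tendsto (fun s : ℝ => T (((1 - s : ℝ) : ℂ) * z₁) * T (z₁ + z₂)) (𝓝[<] 1)
      (𝓝 (T (z₁ + z₂))) := by
    have := ((h.tendsto_mul hα' hM hε hεα).comp hto).mul_const (μ • T (z₁ + z₂) - D)
    rw [hB] at this
    refine this.congr fun s => ?_
    rw [Function.comp_apply, mul_assoc, hB]
  have l2 : Tendsto (fun s : ℝ => T (z₂ + (s : ℂ) * z₁)) (𝓝[<] 1) (𝓝 (T (z₁ + z₂))) := by
    have hc : Tendsto (fun s : ℝ => z₂ + (s : ℂ) * z₁) (𝓝[<] 1) (𝓝 (z₁ + z₂)) := by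
      have : Continuous fun s : ℝ => z₂ + (s : ℂ) * z₁ := by fun_prop
      simpa [add_comm] using (this.tendsto 1).mono_left nhdsWithin_le_nhds
    exact hD.continuousAt.tendsto.comp hc
  have l3 : Tendsto (fun s : ℝ => T (((1 - s : ℝ) : ℂ) * z₁) *
      (T (z₂ + (s : ℂ) * z₁) - T (z₁ + z₂))) (𝓝[<] 1) (𝓝 0) := by
    set K := M * (Real.exp 1 + 1 / (Real.pi * Real.sin (ε / 2)))
    have hz : Tendsto (fun s : ℝ => K * ‖T (z₂ + (s : ℂ) * z₁) - T (z₁ + z₂)‖) (𝓝[<] 1)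
        (𝓝 0) := by
      simpa using ((tendsto_iff_norm_sub_tendsto_zero.1 l2).const_mul K)
    refine squeeze_zero_norm' ?_ hz
    filter_upwards [hev] with s hs
    refine (norm_mul_le _ _).trans ?_
    gcongr
    exact norm_invLaplace_le hM hα' h.diff h.bound hε hεα
      (ofReal_mul_mem_sector hz₁' (by linarith [hs.2]))
  have l4 := l3.add l1
  rw [zero_add] at l4
  refine tendsto_nhds_unique l4 (Tendsto.congr' ?_ tendsto_const_nhds)
  filter_upwards [hev] with s hs
  rw [← hconst s hs.1 hs.2, mul_sub]
  abel

theorem laplace_eq {l : ℝ} (h : IsLogResolvent F α M (l : ℂ) S) (hl : 0 < l) (hα : 0 < α)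
    (hα' : α ≤ Real.pi / 2) (hM : 0 ≤ M) :
    IntegrableOn (fun t : ℝ => Real.exp (-(l * t)) • invLaplace F α (t : ℂ)) (Set.Ioi 0) ∧
    ∫ t in Set.Ioi (0 : ℝ), Real.exp (-(l * t)) • invLaplace F α (t : ℂ) = S := by
  set T := invLaplace F α with hT
  set ε := α / 2 with hεd
  have hε : 0 < ε := by linarith
  have hεα : ε < α := by linarith
  set K := M * (Real.exp 1 + 1 / (Real.pi * Real.sin (ε / 2)))
  have hK : ∀ t : ℝ, 0 < t → ‖T t‖ ≤ K := fun t ht =>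
    norm_invLaplace_le hM hα' h.diff h.bound hε hεα (ofReal_mem_sector (by linarith) ht)
  have hcont : ContinuousOn (fun t : ℝ => T t) (Set.Ioi 0) := fun t ht => by
    obtain ⟨D, hD, -⟩ := h.exists_hasDerivAt hα' (ofReal_mem_sector hα ht)
    exact (hasDerivAt_comp_ofReal hD).continuousAt.continuousWithinAt
  have hexp : IntegrableOn (fun t : ℝ => Real.exp (-(l * t)) * K) (Set.Ioi 0) := by
    have := (integrableOn_exp_mul_Ioi (neg_neg_of_pos hl) 0).mul_const K
    simp only [neg_mul] at this
    exact this
  have hint : IntegrableOn (fun t : ℝ => Real.exp (-(l * t)) • T (t : ℂ)) (Set.Ioi 0) := by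
    refine Integrable.mono' hexp ?_ ?_
    · exact ((by fun_prop : Continuous fun t : ℝ => Real.exp (-(l * t))).continuousOn.smul
        hcont).aestronglyMeasurable measurableSet_Ioi
    · filter_upwards [ae_restrict_mem measurableSet_Ioi] with t ht
      rw [norm_smul, Real.norm_eq_abs, Real.abs_exp]
      gcongr
      exact hK t ht
  refine ⟨hint, ?_⟩
  set g : ℝ → X →L[ℂ] X := fun t => Real.exp (-(l * t)) • (T (t : ℂ) * S) with hg
  have hder : ∀ t : ℝ, 0 < t → HasDerivAt g (-(Real.exp (-(l * t)) • T (t : ℂ))) t := by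
    intro t ht
    obtain ⟨D, hD, hDS, -, -⟩ := h.exists_hasDerivAt hα' (ofReal_mem_sector hα ht)
    have i1 : HasDerivAt (fun t : ℝ => Real.exp (-(l * t))) (Real.exp (-(l * t)) * (-l)) t := by
      have := ((hasDerivAt_id t).const_mul l).neg.exp
      simpa using this
    have i2 := i1.smul ((hasDerivAt_comp_ofReal hD).mul_const S)
    refine i2.congr_deriv ?_
    rw [hDS, ← hT, Complex.coe_smul]
    module
  have h0 : Tendsto g (𝓝[>] 0) (𝓝 S) := by
    have hto : Tendsto (fun t : ℝ => (t : ℂ)) (𝓝[>] 0) (𝓝[sector (α - ε)] 0) := by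
      refine tendsto_nhdsWithin_iff.2 ⟨?_, ?_⟩
      · simpa using (Complex.continuous_ofReal.tendsto 0).mono_left nhdsWithin_le_nhds
      · filter_upwards [self_mem_nhdsWithin] with t ht
        exact ofReal_mem_sector (by linarith) ht
    have he : Tendsto (fun t : ℝ => Real.exp (-(l * t))) (𝓝[>] 0) (𝓝 1) := by
      have : Continuous fun t : ℝ => Real.exp (-(l * t)) := by fun_prop
      simpa using (this.tendsto 0).mono_left nhdsWithin_le_nhds
    simpa using he.smul ((h.tendsto_mul hα' hM hε hεα).comp hto)
  have hinf : Tendsto g atTop (𝓝 0) := by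
    have he : Tendsto (fun t : ℝ => Real.exp (-(l * t)) * (K * ‖S‖)) atTop (𝓝 0) := by
      have : Tendsto (fun t : ℝ => Real.exp (-(l * t))) atTop (𝓝 0) :=
        Real.tendsto_exp_neg_atTop_nhds_zero.comp (tendsto_id.const_mul_atTop hl)
      simpa using this.mul_const (K * ‖S‖)
    refine squeeze_zero_norm' ?_ he
    filter_upwards [eventually_gt_atTop 0] with t ht
    rw [hg, norm_smul, Real.norm_eq_abs, Real.abs_exp]
    gcongr
    exact (norm_mul_le _ _).trans (by gcongr; exact hK t ht)
  have hupd : ∀ t : ℝ, 0 < t → Function.update g 0 S =ᶠ[𝓝 t] g := fun t ht => by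
    filter_upwards [lt_mem_nhds ht] with s hs
    exact Function.update_of_ne hs.ne' _ _
  have key := integral_Ioi_of_hasDerivAt_of_tendsto (a := (0 : ℝ)) (f := Function.update g 0 S)
    (f' := fun t => -(Real.exp (-(l * t)) • T (t : ℂ))) (m := 0) ?_
    (fun t ht => (hder t ht).congr_of_eventuallyEq (hupd t ht)) hint.neg
    (hinf.congr' ?_)
  · rw [integral_neg, Function.update_self, zero_sub, neg_inj] at key
    exact key
  · rw [← Set.Ioi_insert, continuousWithinAt_insert_self]
    rw [continuousWithinAt_update_same]
    refine h0.mono_left (nhdsWithin_mono _ Set.sdiff_subset)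
  · filter_upwards [eventually_gt_atTop 0] with t ht
    exact (Function.update_of_ne ht.ne' _ _).symm

end IsLogResolvent

end LogResolvent

theorem exp_mem_sector {β : ℝ} (hβ : β ≤ Real.pi) {ζ : ℂ} (hζ : |ζ.im| < β) :
    Complex.exp ζ ∈ sector β := by
  have h := abs_lt.1 hζ
  refine ⟨Complex.exp_ne_zero ζ, ?_⟩
  rwa [← Complex.log_im, Complex.log_exp (by linarith) (by linarith)]

variable {X : Type*} [NormedAddCommGroup X] [NormedSpace ℂ X] {A : Submodule ℂ (X × X)}

theorem _root_.IsResolventOf.resolvent_identity {l m : ℂ} {Q S : X →L[ℂ] X}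
    (hQ : IsResolventOf A l Q) (hS : IsResolventOf A m S) : Q = S + (m - l) • (S * Q) := by
  ext u
  obtain ⟨y, hy, hu⟩ := (hQ u (Q u)).2 rfl
  have := (hS (m • Q u - y) (Q u)).1 ⟨y, hy, rfl⟩
  have e : m • Q u - y = u + (m - l) • Q u := by rw [sub_smul]; nth_rw 2 [hu]; abel
  rw [e, map_add, map_smul] at this
  exact this

theorem _root_.IsResolventOf.mul_comm {l m : ℂ} {Q S : X →L[ℂ] X}
    (hQ : IsResolventOf A l Q) (hS : IsResolventOf A m S) : Q * S = S * Q := by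
  have h1 := hQ.resolvent_identity hS
  have h2 := hS.resolvent_identity hQ
  rcases eq_or_ne m l with rfl | hne
  · have : Q = S := by simpa using h1
    rw [this]
  · have h3 : (m - l) • (Q * S) = (m - l) • (S * Q) := by
      have e1 : (m - l) • (S * Q) = Q - S := by nth_rw 2 [h1]; abel
      have e2 : (l - m) • (Q * S) = S - Q := by nth_rw 2 [h2]; abel
      rw [e1, ← neg_sub l m, neg_smul, e2, neg_sub]
    exact smul_right_injective _ (sub_ne_zero.2 hne) h3

theorem isOpen_strip (β : ℝ) : IsOpen {ζ : ℂ | |ζ.im| < β} :=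
  isOpen_lt (by fun_prop) continuous_const

theorem isLogResolvent {α M : ℝ} (hα' : α ≤ Real.pi / 2) {R : ℂ → X →L[ℂ] X}
    (hR : ∀ l ∈ sector (α + Real.pi / 2), IsResolventOf A l (R l))
    (hRM : ∀ l ∈ sector (α + Real.pi / 2), ‖l • R l‖ ≤ M) {m : ℂ}
    (hm : m ∈ sector (α + Real.pi / 2)) :
    IsLogResolvent (fun ζ => Complex.exp ζ • R (Complex.exp ζ)) α M m (R m) := by
  have hexp : ∀ ζ : ℂ, |ζ.im| < α + Real.pi / 2 → Complex.exp ζ ∈ sector (α + Real.pi / 2) :=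
    fun ζ hζ => exp_mem_sector (by linarith) hζ
  refine ⟨?_, fun ζ hζ => hRM _ (hexp ζ hζ), fun ζ hζ => ?_, fun ζ hζ => ?_⟩
  · set F : ℂ → X →L[ℂ] X := fun ζ => Complex.exp ζ • R (Complex.exp ζ) with hF
    set g : ℂ → X →L[ℂ] X := fun ζ => R (Complex.exp ζ) with hg
    intro ζ₀ h₀
    have hnhds := (isOpen_strip (α + Real.pi / 2)).mem_nhds h₀
    set k : ℂ → ℂ := fun ζ => Complex.exp (ζ₀ - ζ) - 1 with hk
    have hkd : HasDerivAt k (-1) ζ₀ := by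
      exact ((((hasDerivAt_id ζ₀).const_sub ζ₀).cexp).sub_const 1).congr_deriv (by simp)
    have hk0 : k ζ₀ = 0 := by simp [hk]
    have hdiff : ∀ ζ : ℂ, |ζ.im| < α + Real.pi / 2 → g ζ - g ζ₀ = k ζ • (g ζ₀ * F ζ) := by
      intro ζ hζ
      have h1 := (hR _ (hexp ζ hζ)).resolvent_identity (hR _ (hexp ζ₀ h₀))
      have h2 : g ζ - g ζ₀ = (Complex.exp ζ₀ - Complex.exp ζ) • (g ζ₀ * g ζ) := by
        rw [sub_eq_iff_eq_add']; exact h1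
      rw [h2, hF, hk]
      simp only [mul_smul_comm, smul_smul, sub_mul, ← Complex.exp_add]
      simp [hg]
    have hgc : ContinuousAt g ζ₀ := by
      have hz : Tendsto (fun ζ => ‖k ζ‖ * (‖g ζ₀‖ * M)) (𝓝 ζ₀) (𝓝 0) := by
        have := (hkd.continuousAt.tendsto.norm).mul_const (‖g ζ₀‖ * M)
        simpa [hk0] using this
      refine tendsto_iff_norm_sub_tendsto_zero.2
        (squeeze_zero' (.of_forall fun _ => norm_nonneg _) ?_ hz)
      filter_upwards [hnhds] with ζ hζ
      rw [hdiff ζ hζ, norm_smul]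
      gcongr
      refine (norm_mul_le _ _).trans ?_
      gcongr
      exact hRM _ (hexp ζ hζ)
    have hFc : ContinuousAt F ζ₀ := Complex.continuous_exp.continuousAt.smul hgc
    have hgd : HasDerivAt g ((-1 : ℂ) • (g ζ₀ * F ζ₀)) ζ₀ := by
      rw [hasDerivAt_iff_tendsto_slope] at hkd ⊢
      refine (hkd.smul ((tendsto_const_nhds.mul hFc.tendsto).mono_left
        nhdsWithin_le_nhds)).congr' ?_
      filter_upwards [mem_nhdsWithin_of_mem_nhds hnhds] with ζ hζ
      rw [slope_def_module, slope_def_module, hdiff ζ hζ, hk0, sub_zero, smul_assoc]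
    exact ((Complex.hasDerivAt_exp ζ₀).smul hgd).differentiableAt.differentiableWithinAt
  · have := (hR _ (hexp ζ hζ)).mul_comm (hR m hm)
    rw [smul_mul_assoc, mul_smul_comm, this]
  · have h1 := (hR m hm).resolvent_identity (hR _ (hexp ζ hζ))
    have h2 : (Complex.exp ζ - m) • (R (Complex.exp ζ) * R m) = R m - R (Complex.exp ζ) := by
      nth_rw 2 [h1]; abel
    rw [smul_mul_assoc, ← sub_eq_zero]
    have h3 := congrArg (Complex.exp ζ • ·) h2
    simp only [smul_sub, sub_smul] at h3 ⊢
    rw [← sub_eq_zero] at h3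
    rw [← h3, smul_comm m]; abel

end Sectorial

/-- Generation theorem for holomorphic semigroups: if `A` is a closed relation on a complex
Banach space with `Σ_{α+π/2} ⊆ ρ(A)` and `‖λ R(λ,A)‖ ≤ M` on `Σ_{α+π/2}`, then `A`
generates a holomorphic semigroup `T : Σ_α → ℒ(X)` with
`‖T(z)‖ ≤ M(1 + 2eπ/sin ε)` on `Σ_{α-ε}` and `R(λ,A)x = ∫₀^∞ e^{-λt} T(t)x dt` for real
`λ > 0`. -/
theorem stmt_18 {X : Type*} [NormedAddCommGroup X] [NormedSpace ℂ X] [CompleteSpace X]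
    (α M : ℝ) (hα : α ∈ Set.Ioc 0 (Real.pi / 2)) (hM : 0 < M)
    (A : Submodule ℂ (X × X)) (hA : IsClosed (A : Set (X × X)))
    (R : ℂ → X →L[ℂ] X)
    (hR : ∀ l ∈ sector (α + Real.pi / 2), IsResolventOf A l (R l))
    (hRM : ∀ l ∈ sector (α + Real.pi / 2), ‖l • R l‖ ≤ M) :
    ∃ T : ℂ → X →L[ℂ] X,
      -- T is holomorphic on Σ_α
      DifferentiableOn ℂ T (sector α) ∧
      -- semigroup property
      (∀ z₁ ∈ sector α, ∀ z₂ ∈ sector α, T (z₁ + z₂) = (T z₁).comp (T z₂)) ∧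
      -- bound on subsectors
      (∀ ε : ℝ, 0 < ε → ε < α → ∀ z ∈ sector (α - ε),
        ‖T z‖ ≤ M * (1 + 2 * Real.exp 1 * Real.pi / Real.sin ε)) ∧
      -- A generates T: the resolvent is the Laplace transform of T
      (∀ l : ℝ, 0 < l → ∀ x : X,
        R (l : ℂ) x = ∫ t in Set.Ioi (0 : ℝ), Real.exp (-(l * t)) • T (t : ℂ) x) := by
  obtain ⟨hα0, hα'⟩ := hα
  have hpi := Real.pi_pos
  have hlog : ∀ l : ℝ, 0 < l → Sectorial.IsLogResolvent
      (fun ζ => Complex.exp ζ • R (Complex.exp ζ)) α M (l : ℂ) (R l) := fun l hl =>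
    Sectorial.isLogResolvent hα' hR hRM (Sectorial.ofReal_mem_sector (by linarith) hl)
  have h1 := hlog 1 one_pos
  refine ⟨Sectorial.invLaplace (fun ζ => Complex.exp ζ • R (Complex.exp ζ)) α, fun z hz => ?_,
    fun z₁ hz₁ z₂ hz₂ => h1.invLaplace_add hα0 hα' hM.le hz₁ hz₂, fun ε hε hεα z hz => ?_,
    fun l hl x => ?_⟩
  · obtain ⟨D, hD, -⟩ := h1.exists_hasDerivAt hα' hz
    exact hD.differentiableAt.differentiableWithinAt
  · exact (Sectorial.norm_invLaplace_le hM.le hα' h1.diff h1.bound hε hεα hz).trans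
      (mul_le_mul_of_nonneg_left (Sectorial.const_le hε (hεα.trans_le hα')) hM.le)
  · obtain ⟨hint, heq⟩ := (hlog l hl).laplace_eq hl hα0 hα' hM.le
    rw [← heq, ContinuousLinearMap.integral_apply hint]
    rfl
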